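/- Let (X,d) be a length metric space and let f : X → ℝ be bounded and Lipschitz with constant L. Then for every s > 0 the function Q_s f is Lipschitz with constant at most 2L, and for every x ∈ X the function s ↦ Q_s f(x) is Lipschitz on [0,∞) with constant at most 2L². -/

import Mathlib

open Filter Topology
open scoped ENNReal NNReal

/-- The Hopf–Lax semigroup `Q_t f(x) = inf_y ( f(y) + d²(x,y)/(2t) )` for `t > 0`,
with `Q_0 f = f`. -/
noncomputable def hopfLax {X : Type*} [MetricSpace X] (f : X → ℝ) (t : ℝ) (x : X) : ℝ :=
  if t ≤ 0 then f x else ⨅ y : X, (f y + dist x y ^ 2 / (2 * t))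

/-- `(X,d)` is a length space: `d(x,y)` is the infimum of the lengths of Lipschitz curves
`γ : [0,1] → X` from `x` to `y`, where the length is the supremum over partitions of sums of
distances of consecutive points (i.e. the total variation of `γ` on `[0,1]`). -/
def IsLengthSpace (X : Type*) [MetricSpace X] : Prop :=
  ∀ x y : X,
    ENNReal.ofReal (dist x y) =
      ⨅ (γ : ℝ → X) (_ : ∃ L : ℝ≥0, LipschitzOnWith L γ (Set.Icc 0 1)) (_ : γ 0 = x)
        (_ : γ 1 = y), eVariationOn γ (Set.Icc 0 1)

/-- In a length space, every distance `a ≤ dist x y` is attained at a point almost on a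
geodesic from `x` to `y`. -/
theorem IsLengthSpace.exists_dist_eq {X : Type*} [MetricSpace X] (hX : IsLengthSpace X)
    (x y : X) {a ε : ℝ} (ha : 0 ≤ a) (hay : a ≤ dist x y) (hε : 0 < ε) :
    ∃ z, dist x z = a ∧ dist z y ≤ dist x y - a + ε := by
  have hlt : ENNReal.ofReal (dist x y) < ENNReal.ofReal (dist x y + ε) :=
    (ENNReal.ofReal_lt_ofReal_iff (by positivity)).2 (by linarith)
  rw [hX x y] at hlt
  simp only [iInf_lt_iff] at hlt
  obtain ⟨γ, ⟨K, hK⟩, h0, h1, hγ⟩ := hlt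
  have hcont : ContinuousOn (fun t => dist x (γ t)) (Set.Icc 0 1) :=
    (continuous_const.dist continuous_id).comp_continuousOn hK.continuousOn
  obtain ⟨t, ht, hta⟩ : a ∈ (fun t => dist x (γ t)) '' Set.Icc (0 : ℝ) 1 :=
    intermediate_value_Icc zero_le_one hcont (by simp [h0, h1, ha, hay])
  refine ⟨γ t, hta, ?_⟩
  have hsplit := eVariationOn.Icc_add_Icc γ (s := Set.univ) ht.1 ht.2 (Set.mem_univ t)
  simp only [Set.univ_inter] at hsplit
  have hleft : edist x (γ t) ≤ eVariationOn γ (Set.Icc 0 t) := by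
    simpa [h0] using eVariationOn.edist_le γ (Set.left_mem_Icc.2 ht.1) (Set.right_mem_Icc.2 ht.1)
  have hright : edist (γ t) y ≤ eVariationOn γ (Set.Icc t 1) := by
    simpa [h1] using eVariationOn.edist_le γ (Set.left_mem_Icc.2 ht.2) (Set.right_mem_Icc.2 ht.2)
  have hsum : edist x (γ t) + edist (γ t) y ≤ ENNReal.ofReal (dist x y + ε) :=
    (add_le_add hleft hright).trans (hsplit.trans_le hγ.le)
  rw [edist_dist, edist_dist, ← ENNReal.ofReal_add dist_nonneg dist_nonneg,
    ENNReal.ofReal_le_ofReal_iff (by positivity)] at hsum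
  have hta' : dist x (γ t) = a := hta
  linarith

theorem hopfLax_le {X : Type*} [MetricSpace X] {f : X → ℝ} {M : ℝ} (hM : ∀ x, M ≤ f x)
    {s : ℝ} (hs : 0 < s) (x y : X) : hopfLax f s x ≤ f y + dist x y ^ 2 / (2 * s) := by
  rw [hopfLax, if_neg hs.not_ge]
  refine ciInf_le ⟨M, ?_⟩ y
  rintro _ ⟨z, rfl⟩
  have : 0 ≤ dist x z ^ 2 / (2 * s) := by positivity
  linarith [hM z]

theorem le_hopfLax {X : Type*} [MetricSpace X] {f : X → ℝ} {s : ℝ} (hs : 0 < s) {x : X} {c : ℝ}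
    (h : ∀ y, c ≤ f y + dist x y ^ 2 / (2 * s)) : c ≤ hopfLax f s x := by
  have : Nonempty X := ⟨x⟩
  rw [hopfLax, if_neg hs.not_ge]
  exact le_ciInf h

/-- Estimate of `Q_s f x` by a competitor at distance `a` from `x` towards `y`. -/
theorem IsLengthSpace.hopfLax_le {X : Type*} [MetricSpace X] (hX : IsLengthSpace X)
    {f : X → ℝ} {M : ℝ} (hM : ∀ x, M ≤ f x) {L : ℝ≥0} (hf : LipschitzWith L f)
    {s : ℝ} (hs : 0 < s) (x y : X) {a : ℝ} (ha : 0 ≤ a) (hay : a ≤ dist x y) :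
    hopfLax f s x ≤ f y + L * (dist x y - a) + a ^ 2 / (2 * s) := by
  refine le_of_forall_pos_le_add fun ε hε => ?_
  have hL : (0 : ℝ) < L + 1 := by positivity
  obtain ⟨z, hxz, hzy⟩ := hX.exists_dist_eq x y ha hay (div_pos hε hL)
  have h1 := _root_.hopfLax_le hM hs x z
  have h2 := hf.le_add_mul z y
  have h3 : (L : ℝ) * dist z y ≤ L * (dist x y - a + ε / (L + 1)) := by gcongr
  have h4 : (L : ℝ) * (ε / (L + 1)) ≤ ε := by
    rw [mul_div_assoc', div_le_iff₀ hL]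
    nlinarith
  rw [hxz] at h1
  linarith

theorem hopfLax_anti {X : Type*} [MetricSpace X] {f : X → ℝ} {M : ℝ} (hM : ∀ x, M ≤ f x)
    (x : X) {s t : ℝ} (hs : 0 ≤ s) (hst : s ≤ t) : hopfLax f t x ≤ hopfLax f s x := by
  rcases hs.eq_or_lt with rfl | hs
  · rcases hst.eq_or_lt with rfl | ht
    · rfl
    · simpa [hopfLax] using hopfLax_le hM ht x x
  · refine le_hopfLax hs fun y => (hopfLax_le hM (hs.trans_le hst) x y).trans ?_
    gcongr

/-- On a length space, `Q_s f` is Lipschitz with the same constant as `f`. -/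
theorem IsLengthSpace.lipschitzWith_hopfLax {X : Type*} [MetricSpace X] (hX : IsLengthSpace X)
    {f : X → ℝ} {M : ℝ} (hM : ∀ x, M ≤ f x) {L : ℝ≥0} (hf : LipschitzWith L f)
    {s : ℝ} (hs : 0 < s) : LipschitzWith L (hopfLax f s) := by
  refine LipschitzWith.of_le_add_mul L fun x' x => ?_
  rw [← sub_le_iff_le_add]
  refine le_hopfLax hs fun y => ?_
  rw [sub_le_iff_le_add]
  have hnn : 0 ≤ (L : ℝ) * dist x' x := by positivity
  rcases le_total (dist x' y) (dist x y) with h | h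
  · have h1 := _root_.hopfLax_le hM hs x' y
    have h2 : dist x' y ^ 2 / (2 * s) ≤ dist x y ^ 2 / (2 * s) := by gcongr
    linarith
  · have h1 := hX.hopfLax_le hM hf hs x' y dist_nonneg h
    have h2 : (L : ℝ) * (dist x' y - dist x y) ≤ L * dist x' x := by
      gcongr
      linarith [dist_triangle x' x y]
    linarith

theorem IsLengthSpace.hopfLax_le_add {X : Type*} [MetricSpace X] (hX : IsLengthSpace X)
    {f : X → ℝ} {M : ℝ} (hM : ∀ x, M ≤ f x) {L : ℝ≥0} (hf : LipschitzWith L f)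
    (x : X) {s t : ℝ} (hs : 0 ≤ s) (hst : s < t) :
    hopfLax f s x ≤ hopfLax f t x + L ^ 2 / 2 * (t - s) := by
  have ht : 0 < t := hs.trans_lt hst
  rw [← sub_le_iff_le_add]
  refine le_hopfLax ht fun y => ?_
  rw [sub_le_iff_le_add]
  set d := dist x y
  have key : f y + L * (d - s / t * d) + s * (d / t) ^ 2 / 2
      ≤ f y + d ^ 2 / (2 * t) + L ^ 2 / 2 * (t - s) := by
    have h : f y + d ^ 2 / (2 * t) + L ^ 2 / 2 * (t - s)
        - (f y + L * (d - s / t * d) + s * (d / t) ^ 2 / 2) = (t - s) / 2 * (L - d / t) ^ 2 := by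
      field_simp
      ring
    have : 0 ≤ (t - s) / 2 * (L - d / t) ^ 2 :=
      mul_nonneg (by linarith) (sq_nonneg _)
    linarith
  refine le_trans ?_ key
  rcases hs.eq_or_lt with rfl | hs
  · simpa [hopfLax] using hf.le_add_mul x y
  · have h1 := hX.hopfLax_le hM hf hs x y (a := s / t * d) (by positivity)
      (mul_le_of_le_one_left dist_nonneg ((div_le_one ht).2 hst.le))
    have h2 : (s / t * d) ^ 2 / (2 * s) = s * (d / t) ^ 2 / 2 := by
      field_simp
    rwa [h2] at h1

/-- On a length metric space, if `f` is bounded and `L`-Lipschitz then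
for every `s > 0` the function `Q_s f` is `2L`-Lipschitz, and for every `x` the function
`s ↦ Q_s f(x)` is `2L²`-Lipschitz on `[0,∞)`. -/
theorem stmt10 {X : Type*} [MetricSpace X] (hX : IsLengthSpace X) (f : X → ℝ)
    (M : ℝ) (hbd : ∀ x, |f x| ≤ M) (L : ℝ≥0) (hf : LipschitzWith L f) :
    (∀ s : ℝ, 0 < s → LipschitzWith (2 * L) (fun x => hopfLax f s x)) ∧
    (∀ x : X, LipschitzOnWith (2 * L ^ 2) (fun s => hopfLax f s x) (Set.Ici 0)) := by
  have hM : ∀ x, -M ≤ f x := fun x => (abs_le.1 (hbd x)).1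
  refine ⟨fun s hs => (hX.lipschitzWith_hopfLax hM hf hs).weaken ?_, fun x => ?_⟩
  · exact le_mul_of_one_le_left' one_le_two
  · refine LipschitzOnWith.of_le_add_mul _ fun s hs t ht => ?_
    have hL : (0 : ℝ) ≤ (L : ℝ) ^ 2 := by positivity
    push_cast
    rcases lt_or_ge s t with hst | hst
    · have h := hX.hopfLax_le_add hM hf x hs hst
      rw [Real.dist_eq, abs_sub_comm, abs_of_pos (sub_pos.2 hst)]
      nlinarith [mul_nonneg hL (sub_pos.2 hst).le]
    · have h := hopfLax_anti hM x ht hst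
      have : 0 ≤ 2 * (L : ℝ) ^ 2 * dist s t := by positivity
      linarith
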